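/- Let m ≥ 2 be an integer and let p be a real number with p ≥ 2m. If ρ > 0 and C > 0 are such that for every positive integer n and every m-linear form T : ℓ_p^n × ⋯ × ℓ_p^n → 𝕂 (𝕂 = ℝ or ℂ) one has (∑_{j_1,…,j_m=1}^n |T(e_{j_1},…,e_{j_m})|^ρ)^{1/ρ} ≤ C‖T‖, then ρ ≥ 2mp/(mp + p − 2m). -/

import Mathlib

open scoped BigOperators

/-- The `ℓ_p` norm of a vector in `𝕂^n`: `(∑ i, ‖x i‖^p)^(1/p)`. -/
noncomputable def lpNorm (𝕂 : Type*) [RCLike 𝕂] (p : ℝ) {n : ℕ} (x : Fin n → 𝕂) : ℝ :=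
  (∑ i, ‖x i‖ ^ p) ^ (1 / p)

/-- The sup norm of an `m`-linear form on `ℓ_p^n × ⋯ × ℓ_p^n`. -/
noncomputable def multilinearNorm (𝕂 : Type*) [RCLike 𝕂] (p : ℝ) {m n : ℕ}
    (T : MultilinearMap 𝕂 (fun _ : Fin m => Fin n → 𝕂) 𝕂) : ℝ :=
  sSup {t : ℝ | ∃ x : Fin m → Fin n → 𝕂, (∀ k, lpNorm 𝕂 p (x k) ≤ 1) ∧ t = ‖T x‖}

/-- The set of sign patterns on a finite type. -/
noncomputable def signPatterns (ι : Type*) [Fintype ι] [DecidableEq ι] : Finset (ι → ℝ) :=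
  Fintype.piFinset fun _ => {1, -1}

lemma mem_signPatterns {ι : Type*} [Fintype ι] [DecidableEq ι] {ε : ι → ℝ} :
    ε ∈ signPatterns ι ↔ ∀ i, ε i = 1 ∨ ε i = -1 := by
  simp [signPatterns]

/-- Hoeffding's estimate for the exponential moment of a Rademacher sum. -/
lemma sum_exp_signPatterns_le {ι : Type*} [Fintype ι] [DecidableEq ι] (a : ι → ℝ) :
    ∑ ε ∈ signPatterns ι, Real.exp (∑ i, ε i * a i) ≤
      (signPatterns ι).card * Real.exp ((∑ i, a i ^ 2) / 2) := by
  have h1 : ∑ ε ∈ signPatterns ι, Real.exp (∑ i, ε i * a i) =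
      ∏ i, ∑ s ∈ ({1, -1} : Finset ℝ), Real.exp (s * a i) := by
    simp only [Real.exp_sum]
    exact Finset.sum_prod_piFinset {1, -1} (fun i s => Real.exp (s * a i))
  have h2 : ∀ i, ∑ s ∈ ({1, -1} : Finset ℝ), Real.exp (s * a i) ≤
      2 * Real.exp (a i ^ 2 / 2) := fun i => by
    rw [Finset.sum_pair (by norm_num)]
    have := Real.cosh_le_exp_half_sq (a i)
    rw [Real.cosh_eq] at this
    simp only [one_mul, neg_one_mul]
    linarith
  have h3 : (({1, -1} : Finset ℝ)).card = 2 := Finset.card_pair (by norm_num)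
  rw [h1]
  refine (Finset.prod_le_prod (fun i _ => by positivity) fun i _ => h2 i).trans_eq ?_
  simp [signPatterns, h3, Finset.prod_mul_distrib, ← Real.exp_sum, Finset.sum_div]

/-- A union bound: some choice of signs makes finitely many Rademacher sums small. -/
lemma exists_signs_abs_sum_le {α ι : Type*} [Fintype ι] [DecidableEq ι] (F : Finset α)
    (a : α → ι → ℝ) {V L : ℝ} (hV : 0 < V) (hL : 0 < L)
    (ha : ∀ y ∈ F, ∑ i, a y i ^ 2 ≤ V) (hF : 2 * (F.card : ℝ) ≤ Real.exp L) :
    ∃ ε : ι → ℝ, (∀ i, ε i = 1 ∨ ε i = -1) ∧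
      ∀ y ∈ F, |∑ i, ε i * a y i| ≤ 2 * (√L * √V) := by
  obtain ⟨c, hc⟩ : ∃ c, c = √L / √V := ⟨_, rfl⟩
  have hlV : 0 < √V := Real.sqrt_pos.2 hV
  have hlL : 0 < √L := Real.sqrt_pos.2 hL
  have hcV : c ^ 2 * V = L := by
    rw [hc, div_pow, Real.sq_sqrt hL.le, Real.sq_sqrt hV.le]; field_simp
  have hc0 : 0 < c := by rw [hc]; positivity
  have key : ∀ y ∈ F, ∀ d : ℝ, d ^ 2 = c ^ 2 →
      ∑ ε ∈ signPatterns ι, Real.exp (d * ∑ i, ε i * a y i) ≤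
        (signPatterns ι).card * Real.exp (L / 2) := by
    intro y hy d hd
    have := sum_exp_signPatterns_le (fun i => d * a y i)
    have e : ∀ ε : ι → ℝ, d * ∑ i, ε i * a y i = ∑ i, ε i * (d * a y i) := fun ε => by
      rw [Finset.mul_sum]; exact Finset.sum_congr rfl fun i _ => by ring
    simp only [e]
    refine this.trans ?_
    gcongr
    simp only [mul_pow, ← Finset.mul_sum, hd]
    calc c ^ 2 * ∑ i, a y i ^ 2 ≤ c ^ 2 * V := by gcongr; exact ha y hy
      _ = L := hcV
  have hne : (signPatterns ι).Nonempty := ⟨fun _ => 1, mem_signPatterns.2 fun _ => Or.inl rfl⟩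
  obtain ⟨ε, hε, hle⟩ := Finset.exists_le_of_sum_le
    (f := fun ε : ι → ℝ => ∑ y ∈ F, (Real.exp (c * ∑ i, ε i * a y i) +
      Real.exp (-c * ∑ i, ε i * a y i)))
    (g := fun _ => 2 * (F.card : ℝ) * Real.exp (L / 2)) hne (by
      rw [Finset.sum_comm]
      calc _ ≤ ∑ y ∈ F, 2 * ((signPatterns ι).card * Real.exp (L / 2)) := by
            refine Finset.sum_le_sum fun y hy => ?_
            rw [Finset.sum_add_distrib]
            linarith [key y hy c rfl, key y hy (-c) (by ring)]
        _ = _ := by simp only [Finset.sum_const, nsmul_eq_mul]; ring)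
  refine ⟨ε, mem_signPatterns.1 hε, fun y hy => ?_⟩
  have h1 : Real.exp (c * ∑ i, ε i * a y i) + Real.exp (-c * ∑ i, ε i * a y i) ≤
      Real.exp (L + L / 2) := by
    rw [Real.exp_add]
    refine (Finset.single_le_sum (f := fun y => Real.exp (c * ∑ i, ε i * a y i) +
      Real.exp (-c * ∑ i, ε i * a y i)) (fun _ _ => by positivity) hy).trans (hle.trans ?_)
    gcongr
  have h2 : c * ∑ i, ε i * a y i ≤ L + L / 2 :=
    Real.exp_le_exp.1 (by linarith [Real.exp_pos (-c * ∑ i, ε i * a y i)])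
  have h3 : -c * ∑ i, ε i * a y i ≤ L + L / 2 :=
    Real.exp_le_exp.1 (by linarith [Real.exp_pos (c * ∑ i, ε i * a y i)])
  have h4 : c * (2 * (√L * √V)) = 2 * L := by
    rw [hc]; field_simp; rw [Real.sq_sqrt hL.le]
  rw [abs_le]
  constructor <;> refine le_of_mul_le_mul_left ?_ hc0 <;> linarith

/-- Truncation towards zero onto the grid of step `1 / N`. -/
lemma exists_int_div_approx {N : ℕ} (hN : 0 < N) {r : ℝ} (hr : |r| ≤ 1) :
    ∃ a ∈ Finset.Icc (-(N : ℤ)) N, |(a : ℝ) / N| ≤ |r| ∧ |r - a / N| ≤ 1 / N := by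
  have hN' : (0 : ℝ) < N := by exact_mod_cast hN
  have main : ∀ r : ℝ, 0 ≤ r → r ≤ 1 →
      ∃ a : ℤ, 0 ≤ a ∧ a ≤ N ∧ (a : ℝ) / N ≤ r ∧ r - a / N ≤ 1 / N := by
    intro r h0 h1
    have hf := Int.floor_le (N * r)
    have hf' := Int.lt_floor_add_one (N * r)
    refine ⟨⌊N * r⌋, Int.floor_nonneg.2 (by positivity), ?_, ?_, ?_⟩
    · have : (⌊N * r⌋ : ℝ) ≤ N := hf.trans (by nlinarith)
      exact_mod_cast this
    · rw [div_le_iff₀ hN']; linarith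
    · rw [sub_le_iff_le_add, ← add_div, le_div_iff₀ hN']; linarith
  obtain ⟨a, ha0, haN, h1, h2⟩ := main |r| (abs_nonneg r) hr
  have hnn : (0 : ℝ) ≤ a / N := div_nonneg (by exact_mod_cast ha0) hN'.le
  rcases le_total 0 r with h | h
  · rw [abs_of_nonneg h] at h1 h2
    refine ⟨a, Finset.mem_Icc.2 ⟨by lia, haN⟩, ?_, ?_⟩
    · rwa [abs_of_nonneg hnn, abs_of_nonneg h]
    · rw [abs_of_nonneg (by linarith)]; exact h2
  · rw [abs_of_nonpos h] at h1 h2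
    refine ⟨-a, Finset.mem_Icc.2 ⟨by lia, by lia⟩, ?_, ?_⟩
    · push_cast; rwa [neg_div, abs_neg, abs_of_nonneg hnn, abs_of_nonpos h]
    · push_cast; rw [neg_div, abs_of_nonpos (by linarith)]; linarith

lemma norm_le_abs_re_add_abs_im {𝕂 : Type*} [RCLike 𝕂] (z : 𝕂) :
    ‖z‖ ≤ |RCLike.re z| + |RCLike.im z| := by
  rw [← sq_le_sq₀ (norm_nonneg _) (by positivity), RCLike.norm_sq_eq_def]
  nlinarith [sq_abs (RCLike.re z), sq_abs (RCLike.im z),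
    mul_nonneg (abs_nonneg (RCLike.re z)) (abs_nonneg (RCLike.im z))]

/-- A finite net of the unit disc of `𝕂` whose approximants do not increase the modulus. -/
lemma exists_finset_approx_unit_ball (𝕂 : Type*) [RCLike 𝕂] {N : ℕ} (hN : 0 < N) :
    ∃ G : Finset 𝕂, G.card ≤ (2 * N + 1) ^ 2 ∧
      ∀ z : 𝕂, ‖z‖ ≤ 1 → ∃ g ∈ G, ‖g‖ ≤ ‖z‖ ∧ ‖z - g‖ ≤ 2 / N := by
  classical
  refine ⟨(Finset.Icc (-(N : ℤ)) N ×ˢ Finset.Icc (-(N : ℤ)) N).image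
    fun q => (((q.1 : ℝ) / N : ℝ) : 𝕂) + (((q.2 : ℝ) / N : ℝ) : 𝕂) * RCLike.I, ?_, ?_⟩
  · refine Finset.card_image_le.trans_eq ?_
    rw [Finset.card_product, Int.card_Icc, sq]
    congr 1 <;> lia
  intro z hz
  have hre := (RCLike.norm_re_le_norm z).trans hz
  have him := (RCLike.norm_im_le_norm z).trans hz
  rw [Real.norm_eq_abs] at hre him
  obtain ⟨a, ha, ha1, ha2⟩ := exists_int_div_approx hN hre
  obtain ⟨b, hb, hb1, hb2⟩ := exists_int_div_approx hN him
  refine ⟨_, Finset.mem_image_of_mem _ (Finset.mk_mem_product ha hb), ?_, ?_⟩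
  · rcases RCLike.I_eq_zero_or_im_I_eq_one (K := 𝕂) with hI | hI
    · simp only [hI, mul_zero, add_zero, RCLike.norm_ofReal]
      exact ha1.trans (by simpa using RCLike.norm_re_le_norm z)
    · rw [← sq_le_sq₀ (norm_nonneg _) (norm_nonneg _), RCLike.norm_sq_eq_def,
        RCLike.norm_sq_eq_def]
      simp only [map_add, RCLike.ofReal_re, RCLike.ofReal_im, RCLike.mul_re, RCLike.mul_im,
        RCLike.I_re, hI]
      have h1 := sq_le_sq.2 ha1
      have h2 := sq_le_sq.2 hb1
      linarith
  · calc _ = ‖((RCLike.re z - (a : ℝ) / N : ℝ) : 𝕂) +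
          ((RCLike.im z - (b : ℝ) / N : ℝ) : 𝕂) * RCLike.I‖ := by
          conv_lhs => rw [← RCLike.re_add_im z]
          push_cast; congr 1; ring
      _ ≤ |RCLike.re z - (a : ℝ) / N| + |RCLike.im z - (b : ℝ) / N| * 1 := by
          refine (norm_add_le _ _).trans ?_
          rw [norm_mul, RCLike.norm_ofReal, RCLike.norm_ofReal]
          gcongr
          by_cases hI : (RCLike.I : 𝕂) = 0
          · simp [hI]
          · exact (RCLike.norm_I_of_ne_zero hI).le
      _ ≤ 1 / N + 1 / N * 1 := by gcongr
      _ = 2 / N := by ring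

lemma norm_prod_sub_prod_le_sum {𝕂 κ : Type*} [RCLike 𝕂] (s : Finset κ) (x y : κ → 𝕂)
    (hx : ∀ k, ‖x k‖ ≤ 1) (hy : ∀ k, ‖y k‖ ≤ 1) :
    ‖∏ k ∈ s, x k - ∏ k ∈ s, y k‖ ≤ ∑ k ∈ s, ‖x k - y k‖ := by
  classical
  induction s using Finset.induction_on with
  | empty => simp
  | insert k s hk ih =>
    rw [Finset.prod_insert hk, Finset.prod_insert hk, Finset.sum_insert hk]
    have hP : ‖∏ k ∈ s, x k‖ ≤ 1 :=
      (Finset.norm_prod_le s x).trans (Finset.prod_le_one (fun _ _ => norm_nonneg _) fun k _ => hx k)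
    calc _ = ‖(x k - y k) * ∏ k ∈ s, x k + y k * (∏ k ∈ s, x k - ∏ k ∈ s, y k)‖ := by
          congr 1; ring
      _ ≤ ‖x k - y k‖ * 1 + 1 * ∑ k ∈ s, ‖x k - y k‖ := by
          refine (norm_add_le _ _).trans ?_
          rw [norm_mul, norm_mul]
          gcongr
          exact hy k
      _ = _ := by ring

/-- The multilinear form with coefficient array `c`. -/
noncomputable def multilinearFormOfCoeffs {𝕂 : Type*} [RCLike 𝕂] {m n : ℕ}
    (c : (Fin m → Fin n) → 𝕂) : MultilinearMap 𝕂 (fun _ : Fin m => Fin n → 𝕂) 𝕂 :=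
  ∑ j, c j • (MultilinearMap.mkPiAlgebra 𝕂 (Fin m) 𝕂).compLinearMap
    fun k => LinearMap.proj (j k)

lemma multilinearFormOfCoeffs_apply {𝕂 : Type*} [RCLike 𝕂] {m n : ℕ}
    (c : (Fin m → Fin n) → 𝕂) (x : Fin m → Fin n → 𝕂) :
    multilinearFormOfCoeffs c x = ∑ j, c j * ∏ k, x k (j k) := by
  simp [multilinearFormOfCoeffs]

lemma multilinearFormOfCoeffs_single {𝕂 : Type*} [RCLike 𝕂] {m n : ℕ}
    (c : (Fin m → Fin n) → 𝕂) (j : Fin m → Fin n) :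
    multilinearFormOfCoeffs c (fun k => Pi.single (j k) (1 : 𝕂)) = c j := by
  rw [multilinearFormOfCoeffs_apply, Finset.sum_eq_single j]
  · simp
  · intro i _ hi
    obtain ⟨k, hk⟩ := Function.ne_iff.1 hi
    rw [Finset.prod_eq_zero (Finset.mem_univ k), mul_zero]
    simp [hk]
  · simp

lemma sum_rpow_le_one_of_lpNorm_le_one {𝕂 : Type*} [RCLike 𝕂] {p : ℝ} (hp : 0 < p) {n : ℕ}
    {x : Fin n → 𝕂} (hx : lpNorm 𝕂 p x ≤ 1) : ∑ i, ‖x i‖ ^ p ≤ 1 := by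
  by_contra! h
  exact absurd hx (not_le.2 (Real.one_lt_rpow h (by positivity)))

lemma norm_le_one_of_lpNorm_le_one {𝕂 : Type*} [RCLike 𝕂] {p : ℝ} (hp : 0 < p) {n : ℕ}
    {x : Fin n → 𝕂} (hx : lpNorm 𝕂 p x ≤ 1) (i : Fin n) : ‖x i‖ ≤ 1 := by
  by_contra! h
  have := Finset.single_le_sum (f := fun i => ‖x i‖ ^ p) (fun _ _ => by positivity)
    (Finset.mem_univ i)
  linarith [sum_rpow_le_one_of_lpNorm_le_one hp hx, Real.one_lt_rpow h hp]

lemma sum_sq_le_of_lpNorm_le_one {𝕂 : Type*} [RCLike 𝕂] {p : ℝ} (hp : 2 ≤ p) {n : ℕ}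
    {x : Fin n → 𝕂} (hx : lpNorm 𝕂 p x ≤ 1) :
    ∑ i, ‖x i‖ ^ 2 ≤ (n : ℝ) ^ (1 - 2 / p) := by
  have hp0 : 0 < p := by linarith
  have h := Real.rpow_sum_le_const_mul_sum_rpow Finset.univ (fun i => ‖x i‖ ^ 2)
    (p := p / 2) (by linarith)
  have e : ∀ i, (‖x i‖ ^ 2) ^ (p / 2) = ‖x i‖ ^ p := fun i => by
    rw [← Real.rpow_natCast_mul (norm_nonneg _)]
    congr 1; push_cast; ring
  simp only [abs_pow, abs_norm, e, Finset.card_univ, Fintype.card_fin] at h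
  have h' : (∑ i, ‖x i‖ ^ 2) ^ (p / 2) ≤ (n : ℝ) ^ (p / 2 - 1) :=
    h.trans (mul_le_of_le_one_right (by positivity) (sum_rpow_le_one_of_lpNorm_le_one hp0 hx))
  have h'' := Real.rpow_le_rpow (by positivity) h' (z := 2 / p) (by positivity)
  rw [← Real.rpow_mul (by positivity), ← Real.rpow_mul (by positivity)] at h''
  have e1 : p / 2 * (2 / p) = 1 := by field_simp
  have e2 : (p / 2 - 1) * (2 / p) = 1 - 2 / p := by field_simp
  rwa [e1, e2, Real.rpow_one] at h''

lemma sum_norm_sq_prod_le {𝕂 : Type*} [RCLike 𝕂] {m n : ℕ} {W : ℝ} {y : Fin m → Fin n → 𝕂}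
    (hy : ∀ k, ∑ i, ‖y k i‖ ^ 2 ≤ W) :
    ∑ j : Fin m → Fin n, ‖∏ k, y k (j k)‖ ^ 2 ≤ W ^ m := by
  have h := Finset.prod_univ_sum (fun _ : Fin m => (Finset.univ : Finset (Fin n)))
    fun k i => ‖y k i‖ ^ 2
  rw [Fintype.piFinset_univ] at h
  simp only [norm_prod, ← Finset.prod_pow]
  rw [← h]
  refine (Finset.prod_le_prod (fun _ _ => by positivity) fun k _ => hy k).trans_eq ?_
  simp

lemma log_net_card_le {m n : ℕ} (hn : 0 < n) :
    4 * ((((2 * n ^ m + 1) ^ 2) ^ n) ^ m : ℝ) ≤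
      Real.exp ((2 + 4 * m + 2 * m ^ 2) * (n * (1 + Real.log n))) := by
  have hn1 : (1 : ℝ) ≤ n := by exact_mod_cast hn
  have hlog := Real.log_nonneg hn1
  have h3 : Real.log 3 ≤ 2 := by
    linarith [Real.log_le_sub_one_of_pos (show (0 : ℝ) < 3 by norm_num)]
  have h4 : Real.log 4 ≤ 2 := by
    rw [show (4 : ℝ) = 2 ^ 2 by norm_num, Real.log_pow]
    have := Real.log_two_lt_d9
    push_cast; linarith
  have hN : (1 : ℝ) ≤ (n : ℝ) ^ m := one_le_pow₀ hn1
  have h5 : Real.log (2 * n ^ m + 1) ≤ 2 + m * Real.log n := by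
    calc Real.log (2 * n ^ m + 1) ≤ Real.log (3 * n ^ m) :=
          Real.log_le_log (by positivity) (by linarith)
      _ = Real.log 3 + m * Real.log n := by
          rw [Real.log_mul (by norm_num) (by positivity), Real.log_pow]
      _ ≤ _ := by linarith
  rw [← Real.log_le_iff_le_exp (by positivity), Real.log_mul (by norm_num) (by positivity),
    Real.log_pow, Real.log_pow, Real.log_pow]
  have h6 : (m : ℝ) * (n * ((2 : ℕ) * Real.log (2 * n ^ m + 1))) ≤
      m * (n * ((2 : ℕ) * (2 + m * Real.log n))) := by gcongr
  have h7 : 0 ≤ (n : ℝ) * Real.log n := by positivity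
  have h8 : 0 ≤ (m : ℝ) * (n * Real.log n) := by positivity
  push_cast at h6 ⊢
  nlinarith

/-- A Kahane-Salem-Zygmund inequality with a logarithmic loss: there are unimodular
coefficients whose multilinear form has small norm. -/
lemma exists_unimodular_multilinearNorm_le (𝕂 : Type*) [RCLike 𝕂] {m n : ℕ} (hn : 0 < n)
    {p : ℝ} (hp : 2 ≤ p) :
    ∃ c : (Fin m → Fin n) → 𝕂, (∀ j, ‖c j‖ = 1) ∧
      multilinearNorm 𝕂 p (multilinearFormOfCoeffs c) ≤
        (4 + 2 * m) * (√((2 + 4 * m + 2 * m ^ 2) * (n * (1 + Real.log n))) *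
          √(((n : ℝ) ^ (1 - 2 / p)) ^ m)) := by
  classical
  have hn1 : (1 : ℝ) ≤ n := by exact_mod_cast hn
  have hlog := Real.log_nonneg hn1
  have hp0 : 0 < p := by linarith
  have hN : 0 < n ^ m := by positivity
  obtain ⟨W, hW⟩ : ∃ W, W = (n : ℝ) ^ (1 - 2 / p) := ⟨_, rfl⟩
  obtain ⟨L, hL⟩ : ∃ L : ℝ, L = (2 + 4 * m + 2 * m ^ 2) * (n * (1 + Real.log n)) := ⟨_, rfl⟩
  have hW1 : 1 ≤ W := by
    rw [hW]
    refine Real.one_le_rpow hn1 ?_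
    rw [sub_nonneg, div_le_one hp0]; exact hp
  have hV1 : 1 ≤ W ^ m := one_le_pow₀ hW1
  have hL1 : 1 ≤ L := by
    rw [hL]
    refine one_le_mul_of_one_le_of_one_le ?_ (one_le_mul_of_one_le_of_one_le hn1 (by linarith))
    have : (0 : ℝ) ≤ 4 * m + 2 * m ^ 2 := by positivity
    linarith
  obtain ⟨G, hGcard, hG⟩ := exists_finset_approx_unit_ball 𝕂 hN
  let F : Finset (Fin m → Fin n → 𝕂) :=
    (Fintype.piFinset fun _ => Fintype.piFinset fun _ => G).filter
      fun y => ∀ k, ∑ i, ‖y k i‖ ^ 2 ≤ W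
  let a : (Fin m → Fin n → 𝕂) × Bool → (Fin m → Fin n) → ℝ := fun q j =>
    if q.2 then RCLike.re (∏ k, q.1 k (j k)) else RCLike.im (∏ k, q.1 k (j k))
  have hFcard : 2 * ((F ×ˢ (Finset.univ : Finset Bool)).card : ℝ) ≤ Real.exp L := by
    have h1 : F.card ≤ (((2 * n ^ m + 1) ^ 2) ^ n) ^ m := by
      refine (Finset.card_filter_le _ _).trans ?_
      simp only [Fintype.card_piFinset, Finset.prod_const, Finset.card_univ, Fintype.card_fin]
      gcongr
    have h2 : (F.card : ℝ) ≤ (((2 * n ^ m + 1) ^ 2) ^ n) ^ m := by exact_mod_cast h1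
    have h3 := log_net_card_le (m := m) hn
    rw [← hL] at h3
    rw [Finset.card_product]
    simp only [Finset.card_univ, Fintype.card_bool]
    push_cast
    linarith
  have ha : ∀ q ∈ F ×ˢ (Finset.univ : Finset Bool), ∑ j, a q j ^ 2 ≤ W ^ m := by
    intro q hq
    have hq' := (Finset.mem_filter.1 (Finset.mem_product.1 hq).1).2
    refine (Finset.sum_le_sum fun j _ => ?_).trans (sum_norm_sq_prod_le hq')
    rw [sq_le_sq, abs_norm]
    simp only [a]
    split_ifs
    · exact RCLike.norm_re_le_norm _
    · exact RCLike.norm_im_le_norm _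
  obtain ⟨ε, hε, hbd⟩ := exists_signs_abs_sum_le _ a (by linarith) (by linarith) ha hFcard
  have hc : ∀ j, ‖((ε j : ℝ) : 𝕂)‖ = 1 := fun j => by
    rw [RCLike.norm_ofReal]; rcases hε j with h | h <;> simp [h]
  refine ⟨fun j => (ε j : 𝕂), hc, ?_⟩
  rw [← hL, ← hW]
  have hLV : 1 ≤ √L * √(W ^ m) :=
    one_le_mul_of_one_le_of_one_le (Real.one_le_sqrt.2 hL1) (Real.one_le_sqrt.2 hV1)
  refine Real.sSup_le ?_ (by positivity)
  rintro t ⟨x, hx, rfl⟩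
  have hx1 : ∀ k i, ‖x k i‖ ≤ 1 := fun k i => norm_le_one_of_lpNorm_le_one hp0 (hx k) i
  choose y hyG hyx hxy using fun k i => hG (x k i) (hx1 k i)
  have hyF : y ∈ F := by
    refine Finset.mem_filter.2 ⟨by simpa [Fintype.mem_piFinset] using hyG, fun k => ?_⟩
    rw [hW]
    refine le_trans ?_ (sum_sq_le_of_lpNorm_le_one hp (hx k))
    gcongr with i
    exact hyx k i
  have hre := hbd (y, true) (by simp [hyF])
  have him := hbd (y, false) (by simp [hyF])
  simp only [a, if_true, Bool.false_eq_true, if_false] at hre him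
  have hTy : ‖multilinearFormOfCoeffs (fun j => (ε j : 𝕂)) y‖ ≤ 4 * (√L * √(W ^ m)) := by
    refine (norm_le_abs_re_add_abs_im _).trans ?_
    rw [multilinearFormOfCoeffs_apply, map_sum, map_sum]
    simp only [RCLike.re_ofReal_mul, RCLike.im_ofReal_mul]
    linarith
  have hTd : ‖multilinearFormOfCoeffs (fun j => (ε j : 𝕂)) x -
      multilinearFormOfCoeffs (fun j => (ε j : 𝕂)) y‖ ≤ 2 * m := by
    rw [multilinearFormOfCoeffs_apply, multilinearFormOfCoeffs_apply, ← Finset.sum_sub_distrib]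
    calc _ ≤ ∑ _j : Fin m → Fin n, (m : ℝ) * (2 / (n ^ m : ℕ)) := by
          refine norm_sum_le_of_le _ fun j _ => ?_
          rw [← mul_sub, norm_mul, hc, one_mul]
          refine (norm_prod_sub_prod_le_sum _ _ _ (fun k => hx1 k (j k))
            fun k => (hyx k (j k)).trans (hx1 k (j k))).trans ?_
          refine (Finset.sum_le_sum fun k _ => hxy k (j k)).trans_eq ?_
          simp
      _ = 2 * m := by
          simp only [Finset.sum_const, Finset.card_univ, Fintype.card_fun, Fintype.card_fin,
            nsmul_eq_mul]
          have : ((n ^ m : ℕ) : ℝ) ≠ 0 := by exact_mod_cast hN.ne'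
          field_simp
  have hm0 : (0 : ℝ) ≤ 2 * m := by positivity
  calc _ ≤ ‖multilinearFormOfCoeffs (fun j => (ε j : 𝕂)) y‖ + _ := norm_le_norm_add_norm_sub' _ _
    _ ≤ 4 * (√L * √(W ^ m)) + 2 * m * (√L * √(W ^ m)) := by
        refine add_le_add hTy (hTd.trans ?_)
        exact le_mul_of_one_le_right hm0 hLV
    _ = _ := by ring

/-- A power of `n` dominated by a constant times `1 + log n` has nonpositive exponent. -/
lemma nonpos_of_rpow_le_log {A δ : ℝ}
    (h : ∀ n : ℕ, 0 < n → (n : ℝ) ^ δ ≤ A * (1 + Real.log n)) : δ ≤ 0 := by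
  by_contra! hδ
  have h1 : (fun x : ℝ => A * (1 + Real.log x)) =o[Filter.atTop] fun x : ℝ => x ^ δ :=
    (((Asymptotics.isLittleO_const_left.2 (Or.inr
      (tendsto_norm_atTop_atTop.comp (tendsto_rpow_atTop hδ)))).add
      (isLittleO_log_rpow_atTop hδ)).const_mul_left A)
  have h2 := (h1.comp_tendsto tendsto_natCast_atTop_atTop).def (c := 1 / 2) (by norm_num)
  obtain ⟨n, hn, hn0⟩ := (h2.and (Filter.eventually_gt_atTop 0)).exists
  have hpos : (0 : ℝ) < (n : ℝ) ^ δ := Real.rpow_pos_of_pos (by exact_mod_cast hn0) _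
  simp only [Function.comp, Real.norm_eq_abs, abs_of_pos hpos] at hn
  linarith [h n hn0, le_abs_self (A * (1 + Real.log n))]

theorem hardy_littlewood_praciano_pereira_optimal
    (𝕂 : Type*) [RCLike 𝕂] (m : ℕ) (hm : 2 ≤ m) (p : ℝ) (hp : 2 * m ≤ p)
    (ρ C : ℝ) (hρ : 0 < ρ) (hC : 0 < C)
    (h : ∀ n : ℕ, 0 < n → ∀ T : MultilinearMap 𝕂 (fun _ : Fin m => Fin n → 𝕂) 𝕂,
      (∑ j : Fin m → Fin n, ‖T (fun k => Pi.single (j k) (1 : 𝕂))‖ ^ ρ) ^ (1 / ρ)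
        ≤ C * multilinearNorm 𝕂 p T) :
    2 * m * p / (m * p + p - 2 * m) ≤ ρ := by
  have hm' : (2 : ℝ) ≤ m := by exact_mod_cast hm
  have hp2 : 2 ≤ p := by linarith
  have hp0 : 0 < p := by linarith
  have key : ∀ n : ℕ, 0 < n →
      (n : ℝ) ^ (2 * (m / ρ) - 1 - (1 - 2 / p) * m) ≤
        (C * (4 + 2 * m)) ^ 2 * (2 + 4 * m + 2 * m ^ 2) * (1 + Real.log n) := by
    intro n hn
    have hn0 : (0 : ℝ) < n := by exact_mod_cast hn
    have hlog : 0 ≤ Real.log n := Real.log_nonneg (by exact_mod_cast hn)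
    obtain ⟨c, hc, hT⟩ := exists_unimodular_multilinearNorm_le 𝕂 (m := m) hn hp2
    have h1 := (h n hn (multilinearFormOfCoeffs c)).trans (mul_le_mul_of_nonneg_left hT hC.le)
    simp only [multilinearFormOfCoeffs_single, hc, Real.one_rpow, Finset.sum_const,
      Finset.card_univ, Fintype.card_fun, Fintype.card_fin, nsmul_eq_mul, mul_one] at h1
    have h2 := pow_le_pow_left₀ (by positivity) h1 2
    rw [mul_pow, mul_pow, mul_pow, Real.sq_sqrt (by positivity), Real.sq_sqrt (by positivity)]
      at h2
    have e1 : (((n ^ m : ℕ) : ℝ) ^ (1 / ρ)) ^ 2 = (n : ℝ) ^ (2 * (m / ρ)) := by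
      rw [Nat.cast_pow, ← Real.rpow_natCast, ← Real.rpow_natCast, ← Real.rpow_mul hn0.le,
        ← Real.rpow_mul hn0.le]
      congr 1; push_cast; ring
    have e2 : ((n : ℝ) ^ (1 - 2 / p)) ^ m = (n : ℝ) ^ ((1 - 2 / p) * m) := by
      rw [← Real.rpow_natCast, ← Real.rpow_mul hn0.le]
    rw [e1, e2] at h2
    rw [Real.rpow_sub hn0, Real.rpow_sub hn0, Real.rpow_one, div_le_iff₀ (by positivity),
      div_le_iff₀ hn0]
    exact h2.trans_eq (by ring)
  have hδ := nonpos_of_rpow_le_log key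
  have hD : 0 < m * p + p - 2 * m := by nlinarith
  rw [div_le_iff₀ hD]
  have h3 : (2 * (m / ρ) - 1 - (1 - 2 / p) * m) * (ρ * p) =
      2 * m * p - ρ * (m * p + p - 2 * m) := by
    field_simp; ring
  have h4 := mul_nonpos_of_nonpos_of_nonneg hδ (mul_pos hρ hp0).le
  linarith
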